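/- Let f be a profile function and let Λ : ℕ → ℝ be the strictly increasing enumeration of E(f) = ⋃_{k ≥ 0} Spec L_k. Then for every m ≥ 1 and every integer k with k > m, Λ(m) is not an eigenvalue of L_k; consequently the set {k : ℕ | k ≥ 1 and Λ(m) ∈ Spec L_k} has at most m elements. -/

import Mathlib

open Set MeasureTheory intervalIntegral Filter

/-- A profile function for a surface of revolution diffeomorphic to `S²` of area `4π`:
continuous on `[-1,1]`, smooth and positive on `(-1,1)`, vanishing at `±1`,
with derivative `2` at `-1` and `-2` at `1`. -/
structure IsProfile (f : ℝ → ℝ) : Prop where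
  contOn : ContinuousOn f (Icc (-1) 1)
  smoothOn : ContDiffOn ℝ (⊤ : ℕ∞) f (Ioo (-1) 1)
  pos : ∀ x ∈ Ioo (-1:ℝ) 1, 0 < f x
  zero_neg_one : f (-1) = 0
  zero_one : f 1 = 0
  deriv_neg_one : HasDerivAt f 2 (-1)
  deriv_one : HasDerivAt f (-2) 1

/-- `λ` is an eigenvalue of the Sturm–Liouville operator
`L_k = -(d/dx)(f(x) d/dx) + k²/f(x)` on `(-1,1)`, with Dirichlet boundary
conditions at `±1` when `k ≥ 1`. -/
def InSpec (f : ℝ → ℝ) (k : ℕ) (lam : ℝ) : Prop :=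
  ∃ u : ℝ → ℝ, ContinuousOn u (Icc (-1) 1) ∧ ContDiffOn ℝ (⊤ : ℕ∞) u (Ioo (-1) 1) ∧
    (∃ x ∈ Ioo (-1:ℝ) 1, u x ≠ 0) ∧
    (1 ≤ k → u (-1) = 0 ∧ u 1 = 0) ∧
    ∀ x ∈ Ioo (-1:ℝ) 1,
      -(deriv (fun y => f y * deriv u y) x) + ((k:ℝ)^2 / f x) * u x = lam * u x

/-- The spectrum of `L_k`. -/
def Spec (f : ℝ → ℝ) (k : ℕ) : Set ℝ := {lam | InSpec f k lam}

/-- The set of distinct eigenvalues of the Laplacian of the surface of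
revolution determined by `f`. -/
def Eigs (f : ℝ → ℝ) : Set ℝ := ⋃ k : ℕ, Spec f k

open scoped Topology InnerProductSpace

theorem exists_eigenvector_of_weak_to_strong {H : Type*} [NormedAddCommGroup H]
    [InnerProductSpace ℝ H] [CompleteSpace H] [TopologicalSpace.SeparableSpace H]
    {T : H →L[ℝ] H} (hT : IsSelfAdjoint T)
    (hcont : ∀ (x : ℕ → H) (x₀ : H), (∀ n, ‖x n‖ ≤ 1) →
      (∀ y, Tendsto (fun n => ⟪y, x n⟫_ℝ) atTop (𝓝 ⟪y, x₀⟫_ℝ)) →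
      Tendsto (fun n => T (x n)) atTop (𝓝 (T x₀)))
    {c : ℝ} (hc : 0 < c) {z : H} (hz : z ≠ 0) (hcz : c * ‖z‖ ^ 2 ≤ ⟪T z, z⟫_ℝ) :
    ∃ M, c ≤ M ∧ ∃ x : H, x ≠ 0 ∧ T x = M • x := by
  set Q : H → ℝ := fun x => ⟪T x, x⟫_ℝ with hQ
  set S := Q '' Metric.closedBall 0 1 with hS
  have hne : S.Nonempty := ⟨_, 0, by simp, rfl⟩
  have hbdd : BddAbove S := by
    refine ⟨‖T‖, ?_⟩
    rintro _ ⟨x, hx, rfl⟩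
    have hx1 : ‖x‖ ≤ 1 := by simpa using hx
    calc Q x ≤ ‖T x‖ * ‖x‖ := real_inner_le_norm _ _
      _ ≤ (‖T‖ * 1) * 1 := by gcongr; exact T.le_opNorm_of_le hx1
      _ = ‖T‖ := by ring
  obtain ⟨q, -, hq, hqS⟩ := exists_seq_tendsto_sSup hne hbdd
  choose x hx hxq using hqS
  have hx1 : ∀ n, ‖x n‖ ≤ 1 := fun n => by simpa using hx n
  obtain ⟨φ, hφ, ψ, hψ, hlim⟩ := WeakDual.isSeqCompact_closedBall ℝ H 0 1
    (x := fun n => StrongDual.toWeakDual (InnerProductSpace.toDual ℝ H (x n)))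
    (fun n => by simpa using hx1 n)
  set x₀ : H := (InnerProductSpace.toDual ℝ H).symm (WeakDual.toStrongDual φ) with hx₀
  have hx₀1 : ‖x₀‖ ≤ 1 := by simpa [hx₀] using hφ
  have hweak : ∀ y, Tendsto (fun n => ⟪y, x (ψ n)⟫_ℝ) atTop (𝓝 ⟪y, x₀⟫_ℝ) := by
    intro y
    have h := ((WeakDual.eval_continuous y).tendsto φ).comp hlim
    have e : ⟪y, x₀⟫_ℝ = φ y := by
      rw [real_inner_comm, hx₀, InnerProductSpace.toDual_symm_apply]; rfl
    rw [e]
    refine h.congr fun n => ?_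
    simp [real_inner_comm]
  have hstrong := hcont (fun n => x (ψ n)) x₀ (fun n => hx1 _) hweak
  have hQlim : Tendsto (fun n => Q (x (ψ n))) atTop (𝓝 (Q x₀)) := by
    have h1 : Tendsto (fun n => ⟪T (x (ψ n)) - T x₀, x (ψ n)⟫_ℝ) atTop (𝓝 0) := by
      refine squeeze_zero_norm (fun n => ?_) (tendsto_iff_norm_sub_tendsto_zero.1 hstrong)
      calc ‖⟪T (x (ψ n)) - T x₀, x (ψ n)⟫_ℝ‖ ≤ ‖T (x (ψ n)) - T x₀‖ * ‖x (ψ n)‖ :=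
            norm_inner_le_norm _ _
        _ ≤ ‖T (x (ψ n)) - T x₀‖ * 1 := by gcongr; exact hx1 _
        _ = _ := mul_one _
    have h2 := h1.add (hweak (T x₀))
    simpa [inner_sub_left, hQ] using h2
  have hmax : Q x₀ = sSup S := by
    refine tendsto_nhds_unique hQlim ?_
    have := hq.comp hψ.tendsto_atTop
    refine this.congr fun n => ?_
    simp [hxq]
  have hle : ∀ y, ‖y‖ ≤ 1 → Q y ≤ Q x₀ := fun y hy => by
    rw [hmax]; exact le_csSup hbdd ⟨y, by simpa using hy, rfl⟩
  have hzpos : 0 < ‖z‖ := norm_pos_iff.2 hz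
  have hcQ : c ≤ Q x₀ := by
    refine le_trans ?_ (hle (‖z‖⁻¹ • z) (by simp [norm_smul, hzpos.ne']))
    simp only [hQ, map_smul, inner_smul_left, inner_smul_right]
    simp only [conj_trivial]
    calc c = ‖z‖⁻¹ * (‖z‖⁻¹ * (c * ‖z‖ ^ 2)) := by field_simp
      _ ≤ _ := by gcongr
  have hx₀0 : x₀ ≠ 0 := by
    intro h
    simp [hQ, h] at hcQ
    linarith
  have hmaxon : IsMaxOn T.reApplyInnerSelf (Metric.sphere (0 : H) ‖x₀‖) x₀ := by
    intro y hy
    have hy' : ‖y‖ = ‖x₀‖ := by simpa using hy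
    have := hle y (hy'.le.trans hx₀1)
    simpa [ContinuousLinearMap.reApplyInnerSelf_apply, hQ] using this
  refine ⟨T.rayleighQuotient x₀, ?_, x₀, hx₀0,
    hT.eq_smul_self_of_isLocalExtrOn_real (Or.inr hmaxon.localize)⟩
  have h0 : 0 < ‖x₀‖ ^ 2 := by positivity
  have h1 : ‖x₀‖ ^ 2 ≤ 1 := pow_le_one₀ (norm_nonneg _) hx₀1
  rw [ContinuousLinearMap.rayleighQuotient, le_div_iff₀ h0]
  calc c * ‖x₀‖ ^ 2 ≤ c * 1 := by gcongr
    _ ≤ _ := by simpa [ContinuousLinearMap.reApplyInnerSelf_apply, hQ] using hcQ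

section Kernel

variable {X : Type*} [MeasurableSpace X] {ν : Measure X} [IsFiniteMeasure ν] {G : X → X → ℝ} {C : ℝ}

theorem memLp_kernel (hG : Measurable (Function.uncurry G)) (hC : ∀ x y, |G x y| ≤ C) (x : X) :
    MemLp (G x) 2 ν :=
  MemLp.of_bound (hG.of_uncurry_left).aestronglyMeasurable C (ae_of_all _ fun y => hC x y)

theorem inner_toLp_kernel (hG : Measurable (Function.uncurry G)) (hC : ∀ x y, |G x y| ≤ C) (x : X)
    (u : Lp ℝ 2 ν) : ⟪(memLp_kernel hG hC x).toLp, u⟫_ℝ = ∫ y, G x y * u y ∂ν := by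
  rw [L2.inner_def]
  refine integral_congr_ae ?_
  filter_upwards [(memLp_kernel (ν := ν) hG hC x).coeFn_toLp] with y hy
  rw [hy]; simp [mul_comm]

theorem norm_inner_toLp_kernel_le (hG : Measurable (Function.uncurry G))
    (hC : ∀ x y, |G x y| ≤ C) (hC0 : 0 ≤ C) (x : X) (u : Lp ℝ 2 ν) :
    ‖⟪(memLp_kernel hG hC x).toLp, u⟫_ℝ‖ ≤ ν.real univ ^ ((2 : ENNReal).toReal)⁻¹ * C * ‖u‖ := by
  refine (norm_inner_le_norm _ _).trans ?_
  gcongr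
  refine Lp.norm_le_of_ae_bound hC0 ?_
  filter_upwards [(memLp_kernel (ν := ν) hG hC x).coeFn_toLp] with y hy
  rw [hy]; exact hC x y

theorem memLp_inner_toLp_kernel (hG : Measurable (Function.uncurry G))
    (hC : ∀ x y, |G x y| ≤ C) (hC0 : 0 ≤ C) (u : Lp ℝ 2 ν) :
    MemLp (fun x => ⟪(memLp_kernel (ν := ν) hG hC x).toLp, u⟫_ℝ) 2 ν := by
  refine MemLp.of_bound ?_ _ (ae_of_all _ fun x => norm_inner_toLp_kernel_le hG hC hC0 x u)
  simp_rw [inner_toLp_kernel hG hC]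
  refine StronglyMeasurable.aestronglyMeasurable ?_
  refine StronglyMeasurable.integral_prod_right' (f := fun p : X × X => G p.1 p.2 * u p.2) ?_
  exact hG.stronglyMeasurable.mul ((Lp.stronglyMeasurable u).comp_measurable measurable_snd)

/-- The integral operator on `L²` with a bounded measurable kernel. -/
noncomputable def kernelOp (hG : Measurable (Function.uncurry G))
    (hC : ∀ x y, |G x y| ≤ C) (hC0 : 0 ≤ C) : Lp ℝ 2 ν →L[ℝ] Lp ℝ 2 ν :=
  LinearMap.mkContinuous
    { toFun := fun u => (memLp_inner_toLp_kernel hG hC hC0 u).toLp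
      map_add' := fun u v => by
        rw [← MemLp.toLp_add]
        congr 1
        ext x
        simp [inner_add_right]
      map_smul' := fun a u => by
        rw [RingHom.id_apply, ← MemLp.toLp_const_smul]
        congr 1
        ext x
        simp [inner_smul_right] }
    (ν.real univ ^ ((2 : ENNReal).toReal)⁻¹ * (ν.real univ ^ ((2 : ENNReal).toReal)⁻¹ * C)) (by
      intro u
      rw [mul_assoc]
      refine Lp.norm_le_of_ae_bound (by positivity) ?_
      filter_upwards [(memLp_inner_toLp_kernel hG hC hC0 u).coeFn_toLp] with y hy
      simp only [LinearMap.coe_mk, AddHom.coe_mk]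
      rw [hy]
      exact norm_inner_toLp_kernel_le hG hC hC0 y u)

theorem kernelOp_ae (hG : Measurable (Function.uncurry G))
    (hC : ∀ x y, |G x y| ≤ C) (hC0 : 0 ≤ C) (u : Lp ℝ 2 ν) :
    kernelOp hG hC hC0 u =ᵐ[ν] fun x => ⟪(memLp_kernel (ν := ν) hG hC x).toLp, u⟫_ℝ :=
  (memLp_inner_toLp_kernel hG hC hC0 u).coeFn_toLp

theorem isSelfAdjoint_kernelOp (hG : Measurable (Function.uncurry G))
    (hC : ∀ x y, |G x y| ≤ C) (hC0 : 0 ≤ C) (hsymm : ∀ x y, G x y = G y x) :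
    IsSelfAdjoint (kernelOp (ν := ν) hG hC hC0) := by
  rw [ContinuousLinearMap.isSelfAdjoint_iff_isSymmetric]
  intro u v
  have key : ∀ u v : Lp ℝ 2 ν,
      ⟪kernelOp hG hC hC0 u, v⟫_ℝ = ∫ x, ∫ y, G x y * (u y * v x) ∂ν ∂ν := by
    intro u v
    rw [L2.inner_def]
    refine integral_congr_ae ?_
    filter_upwards [kernelOp_ae hG hC hC0 u] with x hx
    rw [hx, inner_toLp_kernel hG hC]
    simp only [RCLike.inner_apply, conj_trivial]
    rw [mul_comm, ← MeasureTheory.integral_mul_const]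
    simp only [mul_assoc]
  have hint : Integrable (Function.uncurry fun x y => G x y * (u y * v x)) (ν.prod ν) := by
    have h1 : Integrable (fun p : X × X => v p.1 * u p.2) (ν.prod ν) :=
      ((Lp.memLp v).integrable (by norm_num)).mul_prod ((Lp.memLp u).integrable (by norm_num))
    have h2 := h1.bdd_mul (f := Function.uncurry G) (c := C) hG.aestronglyMeasurable
      (ae_of_all _ fun p => hC p.1 p.2)
    refine h2.congr (ae_of_all _ fun p => ?_)
    simp [Function.uncurry, mul_comm]
  simp only [ContinuousLinearMap.coe_coe]
  rw [key, real_inner_comm, key, integral_integral_swap hint]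
  simp_rw [mul_comm (u _) (v _), hsymm]

theorem tendsto_kernelOp (hG : Measurable (Function.uncurry G))
    (hC : ∀ x y, |G x y| ≤ C) (hC0 : 0 ≤ C) (u : ℕ → Lp ℝ 2 ν) (u₀ : Lp ℝ 2 ν)
    (hu : ∀ n, ‖u n‖ ≤ 1)
    (hweak : ∀ y, Tendsto (fun n => ⟪y, u n⟫_ℝ) atTop (𝓝 ⟪y, u₀⟫_ℝ)) :
    Tendsto (fun n => kernelOp hG hC hC0 (u n)) atTop (𝓝 (kernelOp hG hC hC0 u₀)) := by
  rw [tendsto_iff_norm_sub_tendsto_zero]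
  set K := ν.real univ ^ ((2 : ENNReal).toReal)⁻¹ * C with hK
  have hK0 : 0 ≤ K := by positivity
  have hsq : Tendsto (fun n => ‖kernelOp hG hC hC0 (u n) - kernelOp hG hC hC0 u₀‖ ^ 2) atTop
      (𝓝 0) := by
    have e : ∀ n, ‖kernelOp hG hC hC0 (u n) - kernelOp hG hC hC0 u₀‖ ^ 2
        = ∫ x, (⟪(memLp_kernel (ν := ν) hG hC x).toLp, u n - u₀⟫_ℝ) ^ 2 ∂ν := by
      intro n
      rw [← map_sub, ← real_inner_self_eq_norm_sq, L2.inner_def]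
      refine integral_congr_ae ?_
      filter_upwards [kernelOp_ae hG hC hC0 (u n - u₀)] with x hx
      rw [hx]; simp [sq]
    simp_rw [e]
    have z : (0 : ℝ) = ∫ x, (0 : ℝ) ∂ν := by simp
    rw [z]
    refine tendsto_integral_of_dominated_convergence (fun _ => (K * (1 + ‖u₀‖)) ^ 2) ?_ ?_ ?_ ?_
    · intro n
      exact ((memLp_inner_toLp_kernel hG hC hC0 (u n - u₀)).aestronglyMeasurable).pow 2
    · exact integrable_const _
    · intro n
      refine ae_of_all _ fun x => ?_
      rw [norm_pow]
      gcongr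
      refine (norm_inner_toLp_kernel_le hG hC hC0 x _).trans ?_
      gcongr
      exact (norm_sub_le _ _).trans (by gcongr; exact hu n)
    · refine ae_of_all _ fun x => ?_
      have := ((hweak (memLp_kernel (ν := ν) hG hC x).toLp).sub_const
        ⟪(memLp_kernel (ν := ν) hG hC x).toLp, u₀⟫_ℝ).pow 2
      simpa [inner_sub_right] using this
  have := hsq.sqrt
  simpa using this

theorem exists_kernel_eigenfunction [MeasurableSpace.CountablyGenerated X]
    (hG : Measurable (Function.uncurry G))
    (hC : ∀ x y, |G x y| ≤ C) (hsymm : ∀ x y, G x y = G y x)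
    {c : ℝ} (hc : 0 < c) {φ : X → ℝ} (hφ : MemLp φ 2 ν) (hφ0 : ∀ᵐ x ∂ν, 0 ≤ φ x)
    (hne : ¬ φ =ᵐ[ν] 0) (hle : ∀ᵐ x ∂ν, c * φ x ≤ ∫ y, G x y * φ y ∂ν) :
    ∃ M, c ≤ M ∧ ∃ U : X → ℝ, Integrable U ν ∧ ¬ U =ᵐ[ν] 0 ∧
      ∀ᵐ x ∂ν, ∫ y, G x y * U y ∂ν = M * U x := by
  have hX : Nonempty X := by
    by_contra h
    rw [not_nonempty_iff] at h
    exact hne (ae_of_all _ fun x => h.elim x)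
  obtain ⟨x₁⟩ := hX
  have hC0 : 0 ≤ C := (abs_nonneg _).trans (hC x₁ x₁)
  have : Fact ((2 : ENNReal) ≠ ⊤) := ⟨by norm_num⟩
  obtain ⟨M, hM, U, hU0, hU⟩ := exists_eigenvector_of_weak_to_strong
    (isSelfAdjoint_kernelOp (ν := ν) hG hC hC0 hsymm) (tendsto_kernelOp hG hC hC0) hc
    (z := hφ.toLp) (by
      intro h
      have h2 := hφ.coeFn_toLp
      rw [h] at h2
      exact hne (h2.symm.trans (Lp.coeFn_zero _ _ _))) (by
      rw [← real_inner_self_eq_norm_sq, L2.inner_def, L2.inner_def,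
        ← MeasureTheory.integral_const_mul]
      refine integral_mono_ae ((L2.integrable_inner _ _).const_mul c) (L2.integrable_inner _ _) ?_
      filter_upwards [kernelOp_ae hG hC hC0 hφ.toLp, hφ.coeFn_toLp, hφ0, hle] with x h1 h2 h3 h4
      rw [h1, inner_toLp_kernel hG hC, h2]
      have e : ∫ y, G x y * (hφ.toLp : Lp ℝ 2 ν) y ∂ν = ∫ y, G x y * φ y ∂ν := by
        refine integral_congr_ae ?_
        filter_upwards [hφ.coeFn_toLp] with y hy
        rw [hy]
      rw [e]
      simp only [RCLike.inner_apply, conj_trivial]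
      nlinarith)
  refine ⟨M, hM, U, (Lp.memLp U).integrable (by norm_num), ?_, ?_⟩
  · intro h
    exact hU0 (Lp.ext (h.trans (Lp.coeFn_zero _ _ _).symm))
  · filter_upwards [kernelOp_ae hG hC hC0 U, Lp.coeFn_smul M U] with x h1 h2
    rw [← inner_toLp_kernel hG hC, ← h1, hU, h2]
    simp

end Kernel

section Coordinate

variable {f : ℝ → ℝ}

/-- The coordinate `x ↦ ∫₀ˣ 1 / f` on `(-1,1)`, in which `f · d/dx` is the plain derivative. -/
noncomputable def arcCoord (f : ℝ → ℝ) : ℝ → ℝ :=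
  (Ioo (-1 : ℝ) 1).indicator fun x => ∫ t in (0 : ℝ)..x, (f t)⁻¹

theorem IsProfile.continuousOn_inv (hf : IsProfile f) :
    ContinuousOn (fun x => (f x)⁻¹) (Ioo (-1) 1) :=
  (hf.contOn.mono Ioo_subset_Icc_self).inv₀ fun x hx => (hf.pos x hx).ne'

theorem IsProfile.hasDerivAt_arcCoord (hf : IsProfile f) {x : ℝ} (hx : x ∈ Ioo (-1 : ℝ) 1) :
    HasDerivAt (arcCoord f) (f x)⁻¹ x := by
  have hnhds : Ioo (-1 : ℝ) 1 ∈ 𝓝 x := isOpen_Ioo.mem_nhds hx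
  have hsub : uIcc 0 x ⊆ Ioo (-1 : ℝ) 1 :=
    ordConnected_Ioo.uIcc_subset ⟨by norm_num, by norm_num⟩ hx
  have h : HasDerivAt (fun x => ∫ t in (0 : ℝ)..x, (f t)⁻¹) (f x)⁻¹ x :=
    integral_hasDerivAt_right ((hf.continuousOn_inv.mono hsub).intervalIntegrable)
      (hf.continuousOn_inv.stronglyMeasurableAtFilter isOpen_Ioo x hx)
      (hf.continuousOn_inv.continuousAt hnhds)
  refine h.congr_of_eventuallyEq ?_
  filter_upwards [hnhds] with y hy
  exact indicator_of_mem hy _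

theorem IsProfile.continuousOn_arcCoord (hf : IsProfile f) :
    ContinuousOn (arcCoord f) (Ioo (-1) 1) :=
  fun _ hx => (hf.hasDerivAt_arcCoord hx).continuousAt.continuousWithinAt

theorem IsProfile.measurable_arcCoord (hf : IsProfile f) : Measurable (arcCoord f) := by
  classical
  have h := hf.continuousOn_arcCoord.measurable_piecewise (g := fun _ => (0 : ℝ))
    continuousOn_const measurableSet_Ioo
  convert h using 1
  ext x
  by_cases hx : x ∈ Ioo (-1 : ℝ) 1
  · simp [piecewise, hx]
  · rw [piecewise_eq_of_notMem _ _ _ hx, arcCoord, indicator_of_notMem hx]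

theorem IsProfile.monotoneOn_arcCoord (hf : IsProfile f) :
    MonotoneOn (arcCoord f) (Ioo (-1) 1) := by
  refine monotoneOn_of_deriv_nonneg (convex_Ioo _ _) hf.continuousOn_arcCoord ?_ ?_
  · rw [interior_Ioo]
    exact fun x hx => (hf.hasDerivAt_arcCoord hx).differentiableAt.differentiableWithinAt
  · rw [interior_Ioo]
    intro x hx
    rw [(hf.hasDerivAt_arcCoord hx).deriv]
    exact (inv_pos.2 (hf.pos x hx)).le

/-- A primitive of `1 / g` tends to infinity at a simple zero of `g`. -/
theorem tendsto_atTop_of_hasDerivAt_inv {F g : ℝ → ℝ} {b c : ℝ} (hg1 : g b = 0)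
    (hg : HasDerivAt g c b) (hpos : ∀ᶠ x in 𝓝[<] b, 0 < g x)
    (hF : ∀ᶠ x in 𝓝[<] b, HasDerivAt F (g x)⁻¹ x) : Tendsto F (𝓝[<] b) atTop := by
  set K := |c| + 1 with hK
  have hK0 : 0 < K := by positivity
  have hslope : ∀ᶠ x in 𝓝[<] b, g x ≤ K * (b - x) := by
    have h1 : Tendsto (slope g b) (𝓝[<] b) (𝓝 c) :=
      (hasDerivAt_iff_tendsto_slope.1 hg).mono_left
        (nhdsWithin_mono _ fun x (hx : x < b) => hx.ne)
    have h2 : -K < c := by rw [hK]; linarith [neg_abs_le c]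
    filter_upwards [h1.eventually_const_lt h2, self_mem_nhdsWithin] with x hx hxb
    have hxb : x < b := hxb
    rw [slope_def_field, hg1, sub_zero, lt_div_iff_of_neg (by linarith)] at hx
    nlinarith
  obtain ⟨a, hab, ha⟩ := mem_nhdsLT_iff_exists_Ioo_subset.1 ((hslope.and hpos).and hF)
  have hab : a < b := hab
  have hderiv : ∀ x ∈ Ioo a b, HasDerivAt (fun y => F y + K⁻¹ * Real.log (b - y))
      ((g x)⁻¹ + K⁻¹ * (-1 / (b - x))) x := by
    intro x hx
    have hl := ((hasDerivAt_id x).const_sub b).log (sub_pos.2 hx.2).ne'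
    exact (ha hx).2.add (hl.const_mul K⁻¹)
  have hmono : MonotoneOn (fun y => F y + K⁻¹ * Real.log (b - y)) (Ioo a b) := by
    refine monotoneOn_of_deriv_nonneg (convex_Ioo _ _)
      (fun x hx => (hderiv x hx).continuousAt.continuousWithinAt) ?_ ?_
    · rw [interior_Ioo]
      exact fun x hx => (hderiv x hx).differentiableAt.differentiableWithinAt
    · rw [interior_Ioo]
      intro x hx
      rw [(hderiv x hx).deriv]
      have h1 : (K * (b - x))⁻¹ ≤ (g x)⁻¹ :=
        inv_anti₀ (ha hx).1.2 (ha hx).1.1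
      have h2 : K⁻¹ * (-1 / (b - x)) = -(K * (b - x))⁻¹ := by
        rw [mul_inv]; ring
      rw [h2]; linarith
  obtain ⟨a₁, ha₁⟩ := nonempty_Ioo.2 hab
  set m := F a₁ + K⁻¹ * Real.log (b - a₁)
  have hlog : Tendsto (fun x => Real.log (b - x)) (𝓝[<] b) atBot := by
    have h0 : Tendsto (fun x => b - x) (𝓝[<] b) (𝓝[>] 0) := by
      refine tendsto_nhdsWithin_iff.2 ⟨?_, ?_⟩
      · have : Tendsto (fun x => b - x) (𝓝 b) (𝓝 (b - b)) := tendsto_const_nhds.sub tendsto_id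
        rw [sub_self] at this
        exact this.mono_left nhdsWithin_le_nhds
      · filter_upwards [self_mem_nhdsWithin] with x hx
        exact sub_pos.2 (mem_Iio.1 hx)
    exact Real.tendsto_log_nhdsGT_zero.comp h0
  have hlow : Tendsto (fun x => m + -K⁻¹ * Real.log (b - x)) (𝓝[<] b) atTop :=
    tendsto_atTop_add_const_left _ _
      (hlog.const_mul_atBot_of_neg (neg_neg_of_pos (inv_pos.2 hK0)))
  refine tendsto_atTop_mono' _ ?_ hlow
  filter_upwards [Ioo_mem_nhdsLT ha₁.2] with x hx
  have := hmono ha₁ ⟨ha₁.1.trans hx.1, hx.2⟩ hx.1.le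
  simp only at this
  linarith

theorem IsProfile.tendsto_arcCoord_one (hf : IsProfile f) :
    Tendsto (arcCoord f) (𝓝[<] 1) atTop := by
  have h : ∀ᶠ x in 𝓝[<] (1 : ℝ), x ∈ Ioo (-1 : ℝ) 1 := Ioo_mem_nhdsLT (by norm_num)
  exact tendsto_atTop_of_hasDerivAt_inv hf.zero_one hf.deriv_one
    (h.mono fun x hx => hf.pos x hx) (h.mono fun x hx => hf.hasDerivAt_arcCoord hx)

theorem IsProfile.tendsto_arcCoord_neg_one (hf : IsProfile f) :
    Tendsto (arcCoord f) (𝓝[>] (-1)) atBot := by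
  have h : ∀ᶠ x in 𝓝[<] (1 : ℝ), -x ∈ Ioo (-1 : ℝ) 1 := by
    filter_upwards [Ioo_mem_nhdsLT (show (-1 : ℝ) < 1 by norm_num)] with x hx
    exact ⟨by linarith [hx.2], by linarith [hx.1]⟩
  have hneg : Tendsto (fun x => -arcCoord f (-x)) (𝓝[<] (1 : ℝ)) atTop := by
    refine tendsto_atTop_of_hasDerivAt_inv (g := fun x => f (-x)) (c := -2) hf.zero_neg_one ?_
      (h.mono fun x hx => hf.pos _ hx) (h.mono fun x hx => ?_)
    · have h2 := hf.deriv_neg_one.comp (1 : ℝ) (hasDerivAt_neg (1 : ℝ))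
      simpa [Function.comp_def] using h2
    · have h2 := ((hf.hasDerivAt_arcCoord hx).comp x (hasDerivAt_neg x)).fun_neg
      simpa [Function.comp_def] using h2
  have h2 := (tendsto_neg_atTop_atBot.comp hneg).comp
    (tendsto_neg_nhdsGT_neg (a := (1 : ℝ)))
  simpa [Function.comp_def] using h2

end Coordinate

section Green

variable {f : ℝ → ℝ} {k : ℝ}

/-- The Green kernel of `-(f u')' + (k² / f) u`. -/
noncomputable def greenKernel (f : ℝ → ℝ) (k x y : ℝ) : ℝ :=
  Real.exp (-(k * |arcCoord f x - arcCoord f y|)) / (2 * k)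

/-- The Green operator of `-(f u')' + (k² / f) u`, extended by zero outside `(-1,1)`. -/
noncomputable def greenOp (f : ℝ → ℝ) (k : ℝ) (v : ℝ → ℝ) : ℝ → ℝ :=
  (Ioo (-1 : ℝ) 1).indicator fun x => ∫ y in Ioo (-1 : ℝ) 1, greenKernel f k x y * v y

theorem greenOp_of_mem (v : ℝ → ℝ) {x : ℝ} (hx : x ∈ Ioo (-1 : ℝ) 1) :
    greenOp f k v x = ∫ y in Ioo (-1 : ℝ) 1, greenKernel f k x y * v y :=
  indicator_of_mem hx _

theorem greenKernel_pos (hk : 0 < k) (x y : ℝ) : 0 < greenKernel f k x y := by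
  unfold greenKernel; positivity

theorem greenKernel_le (hk : 0 < k) (x y : ℝ) : greenKernel f k x y ≤ 1 / (2 * k) := by
  unfold greenKernel
  gcongr
  rw [Real.exp_le_one_iff, neg_nonpos]
  positivity

theorem abs_greenKernel_le (hk : 0 < k) (x y : ℝ) : |greenKernel f k x y| ≤ 1 / (2 * k) := by
  rw [abs_of_pos (greenKernel_pos hk x y)]
  exact greenKernel_le hk x y

theorem greenKernel_comm (x y : ℝ) : greenKernel f k x y = greenKernel f k y x := by
  rw [greenKernel, abs_sub_comm, greenKernel]

theorem greenKernel_anti {j : ℝ} (hj : 0 < j) (hjk : j ≤ k) (x y : ℝ) :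
    greenKernel f k x y ≤ j / k * greenKernel f j x y := by
  have hk := hj.trans_le hjk
  unfold greenKernel
  have e : j / k * (Real.exp (-(j * |arcCoord f x - arcCoord f y|)) / (2 * j))
      = Real.exp (-(j * |arcCoord f x - arcCoord f y|)) / (2 * k) := by
    field_simp
  rw [e]
  gcongr

theorem IsProfile.measurable_greenKernel (hf : IsProfile f) :
    Measurable (Function.uncurry (greenKernel f k)) := by
  have h1 : Measurable fun p : ℝ × ℝ => arcCoord f p.1 := hf.measurable_arcCoord.comp measurable_fst
  have h2 : Measurable fun p : ℝ × ℝ => arcCoord f p.2 := hf.measurable_arcCoord.comp measurable_snd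
  have h3 : Measurable fun p : ℝ × ℝ => |arcCoord f p.1 - arcCoord f p.2| := by
    simpa only [Real.norm_eq_abs, Pi.sub_apply] using (h1.sub h2).norm
  exact (Real.measurable_exp.comp (h3.const_mul k).neg).div_const _

theorem IsProfile.integrable_greenKernel_mul (hf : IsProfile f) (hk : 0 < k) (x : ℝ) {v : ℝ → ℝ}
    (hv : IntegrableOn v (Ioo (-1) 1)) :
    IntegrableOn (fun y => greenKernel f k x y * v y) (Ioo (-1) 1) :=
  Integrable.bdd_mul (c := 1 / (2 * k)) hv
    hf.measurable_greenKernel.of_uncurry_left.aestronglyMeasurable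
    (ae_of_all _ fun y => abs_greenKernel_le hk x y)

theorem IsProfile.tendsto_integral_greenKernel (hf : IsProfile f) (hk : 0 < k) {v h : ℝ → ℝ}
    (hv : IntegrableOn v (Ioo (-1) 1)) {l : Filter ℝ} [l.IsCountablyGenerated]
    (hlim : ∀ y, Tendsto (fun x => greenKernel f k x y) l (𝓝 (h y))) :
    Tendsto (fun x => ∫ y in Ioo (-1 : ℝ) 1, greenKernel f k x y * v y) l
      (𝓝 (∫ y in Ioo (-1 : ℝ) 1, h y * v y)) := by
  refine tendsto_integral_filter_of_dominated_convergence (fun y => 1 / (2 * k) * |v y|) ?_ ?_ ?_ ?_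
  · exact Eventually.of_forall fun x => (hf.integrable_greenKernel_mul hk x hv).aestronglyMeasurable
  · refine Eventually.of_forall fun x => ae_of_all _ fun y => ?_
    rw [norm_mul]
    exact mul_le_mul_of_nonneg_right (abs_greenKernel_le hk x y) (abs_nonneg _)
  · exact hv.abs.const_mul _
  · exact ae_of_all _ fun y => (hlim y).mul_const _

theorem tendsto_greenKernel_zero (hk : 0 < k) {l : Filter ℝ} (y : ℝ)
    (hl : Tendsto (fun x => |arcCoord f x|) l atTop) :
    Tendsto (fun x => greenKernel f k x y) l (𝓝 0) := by
  have h1 : Tendsto (fun x => |arcCoord f x - arcCoord f y|) l atTop := by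
    refine tendsto_atTop_mono (fun x => abs_sub_abs_le_abs_sub _ _) ?_
    exact tendsto_atTop_add_const_right _ _ hl
  have h2 := Real.tendsto_exp_neg_atTop_nhds_zero.comp (h1.const_mul_atTop hk)
  simpa [greenKernel, Function.comp_def] using h2.div_const (2 * k)

theorem IsProfile.continuousOn_greenOp (hf : IsProfile f) (hk : 0 < k) {v : ℝ → ℝ}
    (hv : IntegrableOn v (Ioo (-1) 1)) : ContinuousOn (greenOp f k v) (Icc (-1) 1) := by
  have hIoo : ∀ x ∈ Ioo (-1 : ℝ) 1, ContinuousAt (greenOp f k v) x := by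
    intro x hx
    have hnhds : Ioo (-1 : ℝ) 1 ∈ 𝓝 x := isOpen_Ioo.mem_nhds hx
    have h1 := hf.tendsto_integral_greenKernel hk hv (l := 𝓝 x) (h := greenKernel f k x) fun y => by
      have hc : ContinuousAt (arcCoord f) x := (hf.hasDerivAt_arcCoord hx).continuousAt
      exact ContinuousAt.div_const (Real.continuous_exp.continuousAt.comp
        (((hc.sub continuousAt_const).abs.const_mul k).neg)) _
    rw [← greenOp_of_mem v hx] at h1
    refine h1.congr' ?_
    filter_upwards [hnhds] with y hy
    exact (greenOp_of_mem v hy).symm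
  have hend : ∀ l : Filter ℝ, l.IsCountablyGenerated → Tendsto (fun x => |arcCoord f x|) l atTop →
      (∀ᶠ x in l, x ∈ Ioo (-1 : ℝ) 1) → Tendsto (greenOp f k v) l (𝓝 0) := by
    intro l _ hl hmem
    have h1 := hf.tendsto_integral_greenKernel hk hv (l := l) (h := fun _ => 0) fun y =>
      tendsto_greenKernel_zero hk y hl
    simp only [zero_mul, integral_zero] at h1
    refine h1.congr' ?_
    filter_upwards [hmem] with y hy
    exact (greenOp_of_mem v hy).symm
  have hr : Tendsto (greenOp f k v) (𝓝[<] 1) (𝓝 0) :=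
    hend _ inferInstance (tendsto_abs_atTop_atTop.comp hf.tendsto_arcCoord_one)
      (Ioo_mem_nhdsLT (by norm_num))
  have hl : Tendsto (greenOp f k v) (𝓝[>] (-1)) (𝓝 0) :=
    hend _ inferInstance (tendsto_abs_atBot_atTop.comp hf.tendsto_arcCoord_neg_one)
      (Ioo_mem_nhdsGT (by norm_num))
  have h1 : greenOp f k v 1 = 0 := indicator_of_notMem (by simp) _
  have h2 : greenOp f k v (-1) = 0 := indicator_of_notMem (by simp) _
  intro x hx
  rcases eq_or_lt_of_le hx.1 with rfl | hx1
  · have : ContinuousWithinAt (greenOp f k v) (Ioi (-1)) (-1) := by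
      rw [ContinuousWithinAt, h2]; exact hl
    exact (continuousWithinAt_Ioi_iff_Ici.1 this).mono Icc_subset_Ici_self
  rcases eq_or_lt_of_le hx.2 with rfl | hx2
  · have : ContinuousWithinAt (greenOp f k v) (Iio 1) 1 := by
      rw [ContinuousWithinAt, h1]; exact hr
    exact (continuousWithinAt_Iio_iff_Iic.1 this).mono Icc_subset_Iic_self
  · exact (hIoo x ⟨hx1, hx2⟩).continuousWithinAt

theorem IsProfile.hasDerivAt_greenOp (hf : IsProfile f) (hk : 0 < k) {v : ℝ → ℝ}
    (hv : IntegrableOn v (Ioo (-1) 1)) (hvc : ContinuousOn v (Ioo (-1) 1)) :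
    ∃ w : ℝ → ℝ, ∀ x ∈ Ioo (-1 : ℝ) 1, HasDerivAt (greenOp f k v) (w x / f x) x ∧
      HasDerivAt w (k ^ 2 / f x * greenOp f k v x - v x) x := by
  set P : ℝ → ℝ := fun x => Real.exp (k * arcCoord f x) with hP
  set N : ℝ → ℝ := fun x => Real.exp (-(k * arcCoord f x)) with hN
  have hPN : ∀ x, P x * N x = 1 := fun x => by
    rw [hP, hN, ← Real.exp_add]; simp
  have hPm : Measurable P := Real.measurable_exp.comp (hf.measurable_arcCoord.const_mul k)
  have hNm : Measurable N := Real.measurable_exp.comp (hf.measurable_arcCoord.const_mul k).neg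
  have hPi : ∀ x ∈ Ioo (-1 : ℝ) 1, IntervalIntegrable (fun y => P y * v y) volume (-1) x := by
    intro x hx
    rw [intervalIntegrable_iff_integrableOn_Ioo_of_le hx.1.le]
    have hsub : Ioo (-1) x ⊆ Ioo (-1 : ℝ) 1 := Ioo_subset_Ioo_right hx.2.le
    refine Integrable.bdd_mul (c := P x) (hv.mono_set hsub) hPm.aestronglyMeasurable ?_
    filter_upwards [ae_restrict_mem measurableSet_Ioo] with y hy
    rw [Real.norm_eq_abs, abs_of_pos (Real.exp_pos _), hP]
    have := hf.monotoneOn_arcCoord (hsub hy) hx hy.2.le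
    simp only
    gcongr
  have hNi : ∀ x ∈ Ioo (-1 : ℝ) 1, IntervalIntegrable (fun y => N y * v y) volume x 1 := by
    intro x hx
    rw [intervalIntegrable_iff_integrableOn_Ioo_of_le hx.2.le]
    have hsub : Ioo x 1 ⊆ Ioo (-1 : ℝ) 1 := Ioo_subset_Ioo_left hx.1.le
    refine Integrable.bdd_mul (c := N x) (hv.mono_set hsub) hNm.aestronglyMeasurable ?_
    filter_upwards [ae_restrict_mem measurableSet_Ioo] with y hy
    rw [Real.norm_eq_abs, abs_of_pos (Real.exp_pos _), hN]
    have := hf.monotoneOn_arcCoord hx (hsub hy) hy.1.le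
    simp only
    gcongr
  set A : ℝ → ℝ := fun x => ∫ y in (-1 : ℝ)..x, P y * v y with hA
  set B : ℝ → ℝ := fun x => ∫ y in x..1, N y * v y with hB
  have hsplit : ∀ x ∈ Ioo (-1 : ℝ) 1,
      greenOp f k v x = (N x * A x + P x * B x) / (2 * k) := by
    intro x hx
    have hGi : IntervalIntegrable (fun y => greenKernel f k x y * v y) volume (-1) 1 := by
      rw [intervalIntegrable_iff_integrableOn_Ioo_of_le (by norm_num)]
      exact hf.integrable_greenKernel_mul hk x hv
    have hsub1 : uIcc (-1) x ⊆ uIcc (-1 : ℝ) 1 := by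
      rw [uIcc_of_le hx.1.le, uIcc_of_le (by norm_num)]; exact Icc_subset_Icc_right hx.2.le
    have hsub2 : uIcc x 1 ⊆ uIcc (-1 : ℝ) 1 := by
      rw [uIcc_of_le hx.2.le, uIcc_of_le (by norm_num)]; exact Icc_subset_Icc_left hx.1.le
    rw [greenOp_of_mem v hx, ← integral_Ioc_eq_integral_Ioo,
      ← intervalIntegral.integral_of_le (by norm_num),
      ← integral_add_adjacent_intervals (hGi.mono_set hsub1) (hGi.mono_set hsub2)]
    have e1 : ∫ y in (-1 : ℝ)..x, greenKernel f k x y * v y = N x / (2 * k) * A x := by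
      rw [hA]; simp only
      rw [← intervalIntegral.integral_const_mul, intervalIntegral.integral_of_le hx.1.le,
        intervalIntegral.integral_of_le hx.1.le, integral_Ioc_eq_integral_Ioo,
        integral_Ioc_eq_integral_Ioo]
      refine setIntegral_congr_fun measurableSet_Ioo fun y hy => ?_
      have := hf.monotoneOn_arcCoord ⟨hy.1, hy.2.trans hx.2⟩ hx hy.2.le
      simp only [greenKernel, hN, hP]
      rw [abs_of_nonneg (by linarith), mul_sub, neg_sub, sub_eq_neg_add, Real.exp_add]
      ring
    have e2 : ∫ y in x..1, greenKernel f k x y * v y = P x / (2 * k) * B x := by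
      rw [hB]; simp only
      rw [← intervalIntegral.integral_const_mul, intervalIntegral.integral_of_le hx.2.le,
        intervalIntegral.integral_of_le hx.2.le, integral_Ioc_eq_integral_Ioo,
        integral_Ioc_eq_integral_Ioo]
      refine setIntegral_congr_fun measurableSet_Ioo fun y hy => ?_
      have := hf.monotoneOn_arcCoord hx ⟨hx.1.trans hy.1, hy.2⟩ hy.1.le
      simp only [greenKernel, hN, hP]
      rw [abs_of_nonpos (by linarith), mul_neg, neg_neg, mul_sub, sub_eq_add_neg, Real.exp_add]
      ring
    rw [e1, e2]; ring
  have hPd : ∀ x ∈ Ioo (-1 : ℝ) 1, HasDerivAt P (P x * (k * (f x)⁻¹)) x := fun x hx =>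
    ((hf.hasDerivAt_arcCoord hx).const_mul k).exp
  have hNd : ∀ x ∈ Ioo (-1 : ℝ) 1, HasDerivAt N (N x * -(k * (f x)⁻¹)) x := fun x hx =>
    ((hf.hasDerivAt_arcCoord hx).const_mul k).fun_neg.exp
  have hPc : ContinuousOn (fun y => P y * v y) (Ioo (-1) 1) :=
    ContinuousOn.mul (fun x hx => (hPd x hx).continuousAt.continuousWithinAt) hvc
  have hNc : ContinuousOn (fun y => N y * v y) (Ioo (-1) 1) :=
    ContinuousOn.mul (fun x hx => (hNd x hx).continuousAt.continuousWithinAt) hvc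
  have hAd : ∀ x ∈ Ioo (-1 : ℝ) 1, HasDerivAt A (P x * v x) x := fun x hx =>
    integral_hasDerivAt_right (hPi x hx) (hPc.stronglyMeasurableAtFilter isOpen_Ioo x hx)
      (hPc.continuousAt (isOpen_Ioo.mem_nhds hx))
  have hBd : ∀ x ∈ Ioo (-1 : ℝ) 1, HasDerivAt B (-(N x * v x)) x := fun x hx =>
    integral_hasDerivAt_left (hNi x hx) (hNc.stronglyMeasurableAtFilter isOpen_Ioo x hx)
      (hNc.continuousAt (isOpen_Ioo.mem_nhds hx))
  refine ⟨fun x => (P x * B x - N x * A x) / 2, fun x hx => ⟨?_, ?_⟩⟩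
  · have h := (((hNd x hx).mul (hAd x hx)).add ((hPd x hx).mul (hBd x hx))).div_const (2 * k)
    refine (h.congr_deriv ?_).congr_of_eventuallyEq ?_
    · have := (hf.pos x hx).ne'
      field_simp
      ring
    · filter_upwards [isOpen_Ioo.mem_nhds hx] with y hy
      exact hsplit y hy
  · have h := (((hPd x hx).mul (hBd x hx)).sub ((hNd x hx).mul (hAd x hx))).div_const 2
    refine h.congr_deriv ?_
    rw [hsplit x hx]
    have := (hf.pos x hx).ne'
    have h1 := hPN x
    field_simp
    linear_combination (-2 * f x * v x) * h1

end Green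

section Spectrum

variable {f : ℝ → ℝ} {k : ℕ} {lam : ℝ}

/-- Uniqueness for the Dirichlet problem `(f u')' = q u` with `q ≥ 0`. -/
theorem IsProfile.eq_zero_of_hasDerivAt (hf : IsProfile f) {d w q : ℝ → ℝ}
    (hd : ContinuousOn d (Icc (-1) 1)) (hd1 : d (-1) = 0) (hd2 : d 1 = 0)
    (hder : ∀ x ∈ Ioo (-1 : ℝ) 1, HasDerivAt d (w x / f x) x)
    (hwder : ∀ x ∈ Ioo (-1 : ℝ) 1, HasDerivAt w (q x * d x) x)
    (hq : ∀ x ∈ Ioo (-1 : ℝ) 1, 0 ≤ q x) {x : ℝ} (hx : x ∈ Icc (-1 : ℝ) 1) : d x = 0 := by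
  obtain ⟨x₀, hx₀, hmax⟩ := isCompact_Icc.exists_isMaxOn (nonempty_Icc.2 (by norm_num)) (hd.pow 2)
  suffices h : d x₀ = 0 by
    have h1 : d x ^ 2 ≤ d x₀ ^ 2 := hmax hx
    rw [h] at h1
    exact pow_eq_zero_iff two_ne_zero |>.1 (le_antisymm (by simpa using h1) (sq_nonneg _))
  rcases eq_or_lt_of_le hx₀.1 with rfl | hl
  · exact hd1
  rcases eq_or_lt_of_le hx₀.2 with rfl | hr
  · exact hd2
  have hx₀' : x₀ ∈ Ioo (-1 : ℝ) 1 := ⟨hl, hr⟩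
  have hsqder : ∀ y ∈ Ioo (-1 : ℝ) 1, HasDerivAt (fun z => d z ^ 2) (2 * (d y * w y) / f y) y :=
    fun y hy => ((hder y hy).pow 2).congr_deriv (by norm_num; ring)
  have hcrit : d x₀ * w x₀ = 0 := by
    have hloc : IsLocalMax (fun z => d z ^ 2) x₀ := hmax.isLocalMax (Icc_mem_nhds hl hr)
    have := hloc.hasDerivAt_eq_zero (hsqder x₀ hx₀')
    have hp := (hf.pos x₀ hx₀').ne'
    field_simp at this
    linarith
  have hmul : ∀ y ∈ Ioo (-1 : ℝ) 1,
      HasDerivAt (fun z => d z * w z) (w y ^ 2 / f y + q y * d y ^ 2) y :=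
    fun y hy => ((hder y hy).mul (hwder y hy)).congr_deriv (by ring)
  have hmono : MonotoneOn (fun z => d z * w z) (Ioo (-1) 1) := by
    refine monotoneOn_of_deriv_nonneg (convex_Ioo _ _)
      (fun y hy => (hmul y hy).continuousAt.continuousWithinAt) ?_ ?_
    · rw [interior_Ioo]
      exact fun y hy => (hmul y hy).differentiableAt.differentiableWithinAt
    · rw [interior_Ioo]
      intro y hy
      rw [(hmul y hy).deriv]
      have := hf.pos y hy
      have := hq y hy
      positivity
  have hsub : Ioo x₀ 1 ⊆ Ioo (-1 : ℝ) 1 := Ioo_subset_Ioo_left hl.le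
  have hsqmono : MonotoneOn (fun z => d z ^ 2) (Icc x₀ 1) := by
    refine monotoneOn_of_deriv_nonneg (convex_Icc _ _)
      ((hd.pow 2).mono (Icc_subset_Icc_left hl.le)) ?_ ?_
    · rw [interior_Icc]
      exact fun y hy => (hsqder y (hsub hy)).differentiableAt.differentiableWithinAt
    · rw [interior_Icc]
      intro y hy
      rw [(hsqder y (hsub hy)).deriv]
      have h1 := hmono hx₀' (hsub hy) hy.1.le
      simp only [hcrit] at h1
      have h2 := hf.pos y (hsub hy)
      positivity
  have := hsqmono (left_mem_Icc.2 hr.le) (right_mem_Icc.2 hr.le) hr.le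
  simp only [hd2] at this
  exact pow_eq_zero_iff two_ne_zero |>.1 (le_antisymm (by simpa using this) (sq_nonneg _))

theorem IsProfile.hasDerivAt_of_equation (hf : IsProfile f) {u : ℝ → ℝ}
    (hu : ContDiffOn ℝ (⊤ : ℕ∞) u (Ioo (-1) 1))
    (heq : ∀ x ∈ Ioo (-1 : ℝ) 1,
      -(deriv (fun y => f y * deriv u y) x) + ((k : ℝ) ^ 2 / f x) * u x = lam * u x)
    {x : ℝ} (hx : x ∈ Ioo (-1 : ℝ) 1) :
    HasDerivAt u (f x * deriv u x / f x) x ∧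
      HasDerivAt (fun y => f y * deriv u y) (((k : ℝ) ^ 2 / f x - lam) * u x) x := by
  have hnhds : Ioo (-1 : ℝ) 1 ∈ 𝓝 x := isOpen_Ioo.mem_nhds hx
  have hne := (hf.pos x hx).ne'
  constructor
  · rw [mul_div_cancel_left₀ _ hne]
    exact ((hu.contDiffAt hnhds).differentiableAt (by simp)).hasDerivAt
  · have hdu : ContDiffOn ℝ (⊤ : ℕ∞) (deriv u) (Ioo (-1) 1) :=
      hu.deriv_of_isOpen isOpen_Ioo (by simp)
    have h1 : DifferentiableAt ℝ (fun y => f y * deriv u y) x :=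
      ((hf.smoothOn.contDiffAt hnhds).differentiableAt (by simp)).mul
        ((hdu.contDiffAt hnhds).differentiableAt (by simp))
    refine h1.hasDerivAt.congr_deriv ?_
    linear_combination -heq x hx

theorem IsProfile.inSpec_of_hasDerivAt (hf : IsProfile f) {u w : ℝ → ℝ}
    (huc : ContinuousOn u (Icc (-1) 1)) (hne : ∃ x ∈ Ioo (-1 : ℝ) 1, u x ≠ 0)
    (hu1 : u (-1) = 0) (hu2 : u 1 = 0)
    (hder : ∀ x ∈ Ioo (-1 : ℝ) 1, HasDerivAt u (w x / f x) x)
    (hwder : ∀ x ∈ Ioo (-1 : ℝ) 1, HasDerivAt w (((k : ℝ) ^ 2 / f x - lam) * u x) x) :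
    InSpec f k lam := by
  have hsmooth : ∀ n : ℕ, ContDiffOn ℝ n u (Ioo (-1) 1) ∧ ContDiffOn ℝ n w (Ioo (-1) 1) := by
    intro n
    induction n with
    | zero =>
      simp only [Nat.cast_zero, contDiffOn_zero]
      exact ⟨fun x hx => (hder x hx).continuousAt.continuousWithinAt,
        fun x hx => (hwder x hx).continuousAt.continuousWithinAt⟩
    | succ n ih =>
      have hfn : ContDiffOn ℝ n f (Ioo (-1) 1) := hf.smoothOn.of_le (by exact_mod_cast le_top)
      have hf0 : ∀ x ∈ Ioo (-1 : ℝ) 1, f x ≠ 0 := fun x hx => (hf.pos x hx).ne'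
      push_cast
      rw [contDiffOn_succ_iff_deriv_of_isOpen isOpen_Ioo,
        contDiffOn_succ_iff_deriv_of_isOpen isOpen_Ioo]
      refine ⟨⟨fun x hx => (hder x hx).differentiableAt.differentiableWithinAt, by simp, ?_⟩,
        ⟨fun x hx => (hwder x hx).differentiableAt.differentiableWithinAt, by simp, ?_⟩⟩
      · exact (ih.2.div hfn hf0).congr fun x hx => (hder x hx).deriv
      · exact (((contDiffOn_const.div hfn hf0).sub contDiffOn_const).mul ih.1).congr
          fun x hx => (hwder x hx).deriv
  refine ⟨u, huc, contDiffOn_infty.2 fun n => (hsmooth n).1, hne, fun _ => ⟨hu1, hu2⟩, ?_⟩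
  intro x hx
  have h : HasDerivAt (fun y => f y * deriv u y) (((k : ℝ) ^ 2 / f x - lam) * u x) x := by
    refine (hwder x hx).congr_of_eventuallyEq ?_
    filter_upwards [isOpen_Ioo.mem_nhds hx] with y hy
    rw [(hder y hy).deriv, mul_div_cancel₀ _ (hf.pos y hy).ne']
  rw [h.deriv]
  ring

theorem zero_inSpec (f : ℝ → ℝ) : InSpec f 0 0 :=
  ⟨fun _ => 1, continuousOn_const, contDiffOn_const, ⟨0, by norm_num, one_ne_zero⟩, by simp,
    by simp⟩

theorem IsProfile.pos_of_inSpec (hf : IsProfile f) (hk : 1 ≤ k) (h : InSpec f k lam) :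
    0 < lam := by
  obtain ⟨u, huc, hus, ⟨x, hx, hux⟩, hbd, heq⟩ := h
  by_contra! hlam
  refine hux (hf.eq_zero_of_hasDerivAt huc (hbd hk).1 (hbd hk).2
    (fun x hx => (hf.hasDerivAt_of_equation hus heq hx).1)
    (fun x hx => (hf.hasDerivAt_of_equation hus heq hx).2) (fun x hx => ?_)
    (Ioo_subset_Icc_self hx))
  have := hf.pos x hx
  have : 0 ≤ (k : ℝ) ^ 2 / f x := by positivity
  linarith

/-- An eigenfunction is reproduced by the Green operator. -/
theorem IsProfile.eq_greenOp (hf : IsProfile f) (hk : 1 ≤ k) {u : ℝ → ℝ}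
    (huc : ContinuousOn u (Icc (-1) 1)) (hus : ContDiffOn ℝ (⊤ : ℕ∞) u (Ioo (-1) 1))
    (hu1 : u (-1) = 0) (hu2 : u 1 = 0)
    (heq : ∀ x ∈ Ioo (-1 : ℝ) 1,
      -(deriv (fun y => f y * deriv u y) x) + ((k : ℝ) ^ 2 / f x) * u x = lam * u x)
    {x : ℝ} (hx : x ∈ Ioo (-1 : ℝ) 1) : u x = greenOp f k (fun y => lam * u y) x := by
  have hk0 : (0 : ℝ) < k := by exact_mod_cast hk
  have hvc : ContinuousOn (fun y => lam * u y) (Icc (-1) 1) := huc.const_mul lam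
  have hv : IntegrableOn (fun y => lam * u y) (Ioo (-1) 1) :=
    hvc.integrableOn_Icc.mono_set Ioo_subset_Icc_self
  obtain ⟨w, hw⟩ := hf.hasDerivAt_greenOp hk0 hv (hvc.mono Ioo_subset_Icc_self)
  have h1 : greenOp f k (fun y => lam * u y) 1 = 0 := indicator_of_notMem (by simp) _
  have h2 : greenOp f k (fun y => lam * u y) (-1) = 0 := indicator_of_notMem (by simp) _
  have := hf.eq_zero_of_hasDerivAt (d := fun x => u x - greenOp f k (fun y => lam * u y) x)
    (w := fun x => f x * deriv u x - w x) (q := fun x => (k : ℝ) ^ 2 / f x)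
    (huc.sub (hf.continuousOn_greenOp hk0 hv)) (by simp [hu1, h2]) (by simp [hu2, h1])
    (fun y hy => ((hf.hasDerivAt_of_equation hus heq hy).1.sub (hw y hy).1).congr_deriv (by ring))
    (fun y hy => ((hf.hasDerivAt_of_equation hus heq hy).2.sub (hw y hy).2).congr_deriv (by ring))
    (fun y hy => div_nonneg (sq_nonneg _) (hf.pos y hy).le) (Ioo_subset_Icc_self hx)
  exact sub_eq_zero.1 this

theorem not_ae_eq_zero_of_continuousOn {φ : ℝ → ℝ} (hφ : ContinuousOn φ (Ioo (-1) 1))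
    (hne : ∃ x ∈ Ioo (-1 : ℝ) 1, φ x ≠ 0) : ¬ φ =ᵐ[volume.restrict (Ioo (-1 : ℝ) 1)] 0 := by
  intro h
  obtain ⟨x, hx, hφx⟩ := hne
  exact hφx (Measure.eqOn_open_of_ae_eq h isOpen_Ioo hφ continuousOn_const hx)

/-- Below every eigenvalue of `L_{j+1}` there is an eigenvalue of `L_j`. -/
theorem IsProfile.exists_inSpec_lt (hf : IsProfile f) {j : ℕ} (h : InSpec f (j + 1) lam) :
    ∃ mu < lam, InSpec f j mu := by
  have hlam := hf.pos_of_inSpec (by omega) h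
  rcases Nat.eq_zero_or_pos j with rfl | hj
  · exact ⟨0, hlam, zero_inSpec f⟩
  have hj0 : (0 : ℝ) < j := by exact_mod_cast hj
  obtain ⟨u, huc, hus, hne, hbd, heq⟩ := h
  obtain ⟨hu1, hu2⟩ := hbd (by omega)
  set ν : Measure ℝ := volume.restrict (Ioo (-1 : ℝ) 1) with hν
  have huc' : ContinuousOn u (Ioo (-1) 1) := huc.mono Ioo_subset_Icc_self
  obtain ⟨K, hK⟩ := isCompact_Icc.exists_bound_of_continuousOn huc
  have huabs : MemLp (fun x => |u x|) 2 ν := by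
    refine MemLp.of_bound (huc'.abs.aestronglyMeasurable measurableSet_Ioo) K ?_
    filter_upwards [ae_restrict_mem measurableSet_Ioo] with x hx
    simpa using hK x (Ioo_subset_Icc_self hx)
  have hui : IntegrableOn (fun x => |u x|) (Ioo (-1) 1) := huabs.integrable (by norm_num)
  have hk0 : (0 : ℝ) < ((j + 1 : ℕ) : ℝ) := by positivity
  set k : ℝ := ((j + 1 : ℕ) : ℝ) with hk
  have hjk : (j : ℝ) < k := by rw [hk]; push_cast; linarith
  have hsub : ∀ x ∈ Ioo (-1 : ℝ) 1,
      k / (j * lam) * |u x| ≤ ∫ y, greenKernel f j x y * |u y| ∂ν := by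
    intro x hx
    have h1 : |u x| ≤ ∫ y, lam * (j / k) * (greenKernel f j x y * |u y|) ∂ν := by
      have e := hf.eq_greenOp (by omega) huc hus hu1 hu2 heq hx
      rw [greenOp_of_mem _ hx, ← hk] at e
      nth_rw 1 [e]
      refine MeasureTheory.abs_integral_le_integral_abs.trans ?_
      refine integral_mono_of_nonneg (ae_of_all _ fun _ => abs_nonneg _)
        ((hf.integrable_greenKernel_mul hj0 x hui).const_mul _) (ae_of_all _ fun y => ?_)
      simp only [abs_mul, abs_of_pos hlam, abs_of_pos (greenKernel_pos hk0 x y)]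
      calc greenKernel f k x y * (lam * |u y|)
          ≤ (j / k * greenKernel f j x y) * (lam * |u y|) := by
            gcongr
            exact greenKernel_anti hj0 hjk.le x y
        _ = _ := by ring
    rw [MeasureTheory.integral_const_mul] at h1
    rw [div_mul_eq_mul_div, div_le_iff₀ (by positivity)]
    calc k * |u x| ≤ k * (lam * (j / k) * ∫ y, greenKernel f j x y * |u y| ∂ν) := by gcongr
      _ = _ := by field_simp
  have hc : 0 < k / (j * lam) := by positivity
  obtain ⟨M, hM, U, hUi, hU0, hU⟩ := exists_kernel_eigenfunction (ν := ν)
    (hf.measurable_greenKernel (k := j)) (abs_greenKernel_le hj0) greenKernel_comm hc huabs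
    (ae_of_all _ fun x => abs_nonneg _)
    (not_ae_eq_zero_of_continuousOn huc'.abs (by simpa using hne))
    ((ae_restrict_mem measurableSet_Ioo).mono hsub)
  have hM0 : 0 < M := hc.trans_le hM
  have hVU : (fun x => M⁻¹ * greenOp f j U x) =ᵐ[ν] U := by
    filter_upwards [hU, ae_restrict_mem measurableSet_Ioo] with x hx hxm
    rw [greenOp_of_mem U hxm, hx]
    field_simp
  set V : ℝ → ℝ := fun x => M⁻¹ * greenOp f j U x with hV
  have hVc : ContinuousOn V (Icc (-1) 1) := (hf.continuousOn_greenOp hj0 hUi).const_mul _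
  have hVi : IntegrableOn V (Ioo (-1) 1) := hUi.congr hVU.symm
  have hVgreen : V = fun x => M⁻¹ * greenOp f j V x := by
    have : greenOp f j V = greenOp f j U := by
      unfold greenOp
      congr 1
      ext x
      refine integral_congr_ae ?_
      filter_upwards [hVU] with y hy
      rw [hy]
    rw [this]
  obtain ⟨w, hw⟩ := hf.hasDerivAt_greenOp hj0 hVi (hVc.mono Ioo_subset_Icc_self)
  refine ⟨M⁻¹, ?_, hf.inSpec_of_hasDerivAt (u := V) (w := fun x => M⁻¹ * w x) hVc ?_ ?_ ?_ ?_ ?_⟩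
  · have h1 : lam⁻¹ < M := by
      refine lt_of_lt_of_le ?_ hM
      rw [lt_div_iff₀ (by positivity)]
      field_simp
      exact hjk
    exact inv_lt_of_inv_lt₀ hlam h1
  · by_contra! hzero
    refine hU0 (hVU.symm.trans ?_)
    filter_upwards [ae_restrict_mem measurableSet_Ioo] with x hx
    exact hzero x hx
  · simp [hV, greenOp]
  · simp [hV, greenOp]
  · intro x hx
    have := (hw x hx).1.const_mul M⁻¹
    rw [← hVgreen] at this
    exact this.congr_deriv (by ring)
  · intro x hx
    refine ((hw x hx).2.const_mul M⁻¹).congr_deriv ?_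
    have e : V x = M⁻¹ * greenOp f j V x := congrFun hVgreen x
    linear_combination (-((j : ℝ) ^ 2 / f x)) * e

theorem IsProfile.le_of_mem_spec (hf : IsProfile f) {Λ : ℕ → ℝ} (hΛmono : StrictMono Λ)
    (hΛrange : Set.range Λ = Eigs f) : ∀ k m : ℕ, Λ m ∈ Spec f k → k ≤ m := by
  intro k
  induction k with
  | zero => exact fun m _ => Nat.zero_le m
  | succ k ih =>
    intro m hm
    obtain ⟨mu, hlt, hmu⟩ := hf.exists_inSpec_lt hm
    have hmem : mu ∈ Set.range Λ := by
      rw [hΛrange]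
      exact mem_iUnion.2 ⟨k, hmu⟩
    obtain ⟨m', rfl⟩ := hmem
    have h1 := ih m' hmu
    have h2 : m' < m := hΛmono.lt_iff_lt.1 hlt
    omega

end Spectrum

/-- For `m ≥ 1`, the `m`-th distinct eigenvalue `Λ m` is not in the spectrum of `L_k`
for any `k > m`; hence at most `m` positive integers `k` have `Λ m ∈ Spec L_k`. -/
theorem eigenvalue_not_in_high_spec (f : ℝ → ℝ) (hf : IsProfile f)
    (Λ : ℕ → ℝ) (hΛmono : StrictMono Λ) (hΛrange : Set.range Λ = Eigs f)
    (m : ℕ) (hm : 1 ≤ m) :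
    (∀ k : ℕ, m < k → Λ m ∉ Spec f k) ∧
    ({k : ℕ | 1 ≤ k ∧ Λ m ∈ Spec f k}).ncard ≤ m := by
  have key := hf.le_of_mem_spec hΛmono hΛrange
  refine ⟨fun k hk h => (key k m h).not_gt hk, ?_⟩
  have hsub : {k : ℕ | 1 ≤ k ∧ Λ m ∈ Spec f k} ⊆ (Finset.Icc 1 m : Finset ℕ) := fun k hk => by
    simpa using ⟨hk.1, key k m hk.2⟩
  calc _ ≤ ((Finset.Icc 1 m : Finset ℕ) : Set ℕ).ncard :=
        ncard_le_ncard hsub (Finset.finite_toSet _)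
    _ = m := by simp
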